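/- For every integer k with 1 ≤ k ≤ r + 1, the quotient space V^{⊗k} / Σ_{a=1}^{k−1} Im((1 − C_q)^{(a,a+1)}) (for k = 1 the quotient of V by the zero subspace) has dimension ((2r − 2k + 2)/k) · binom(2r + 1, k − 1). (This quotient realizes the k-th graded component of the quadratic algebra Ξ_{C_q}(K), so dim Ξ_{C_q}(K)_k = ((2r − 2k + 2)/k) · binom(2r + 1, k − 1).) -/

import Mathlib

open scoped BigOperators

noncomputable section

/-- The index set `I = {-r, …, -1, 1, …, r}` as a subtype of `ℤ`. -/
abbrev SIdx (r : ℕ) : Type := {i : ℤ // i ∈ (Finset.Icc (-(r : ℤ)) (r : ℤ)).erase 0}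

instance (r : ℕ) : Neg (SIdx r) :=
  ⟨fun i => ⟨-i.1, by
    obtain ⟨h1, h2⟩ := Finset.mem_erase.mp i.2
    rw [Finset.mem_Icc] at h2
    exact Finset.mem_erase.mpr ⟨neg_ne_zero.mpr h1, Finset.mem_Icc.mpr (by omega)⟩⟩⟩

/-- The sign `ε_i`: `1` for `i > 0` and `-1` for `i < 0`, as an element of `K`. -/
def sgn (K : Type*) [Field K] {r : ℕ} (i : SIdx r) : K := if 0 < i.1 then 1 else -1

/-- A symplectic parameter family `q = (q_{ij}, q_i)`: nonzero scalars with
`q_{ij} = q_{ji}⁻¹`, `q_{ii} = 1`, `q_{-i} = q_i⁻¹` and `q_{-i,j} = q_{ij}⁻¹ q_j²`. -/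
structure SympParam (K : Type*) [Field K] (r : ℕ) where
  qm : SIdx r → SIdx r → K
  qv : SIdx r → K
  qm_ne : ∀ i j, qm i j ≠ 0
  qv_ne : ∀ i, qv i ≠ 0
  qm_symm : ∀ i j, qm i j = (qm j i)⁻¹
  qm_diag : ∀ i, qm i i = 1
  qv_neg : ∀ i, qv (-i) = (qv i)⁻¹
  qm_neg : ∀ i j, qm (-i) j = (qm i j)⁻¹ * (qv j) ^ 2

variable {K : Type*} [Field K] [CharZero K] {r : ℕ}

/-- The operator `P_q` on `V ⊗ V`, where `V = SIdx r → K` and `V ⊗ V` is realized as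
`(SIdx r × SIdx r) → K` with basis vector `e l ⊗ e m = Pi.single (l, m) 1`.  It sends
`e l ⊗ e m ↦ q_{lm} • (e m ⊗ e l)`. -/
def Pq (q : SympParam K r) : Module.End K (SIdx r × SIdx r → K) where
  toFun f := fun p => q.qm p.2 p.1 * f (p.2, p.1)
  map_add' f g := by funext p; simp [mul_add]
  map_smul' c f := by funext p; simp [smul_eq_mul]; ring

/-- The operator `Q_q` on `V ⊗ V`: it sends
`e l ⊗ e m ↦ δ_{m,-l} ε_l q_l⁻¹ • ∑ i, ε_i q_i • (e i ⊗ e (-i))`. -/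
def Qq (q : SympParam K r) : Module.End K (SIdx r × SIdx r → K) where
  toFun f := fun p =>
    if p.2 = -p.1 then
      sgn K p.1 * q.qv p.1 * ∑ l : SIdx r, sgn K l * (q.qv l)⁻¹ * f (l, -l)
    else 0
  map_add' f g := by
    funext p
    by_cases h : p.2 = -p.1 <;> simp [h, mul_add, Finset.sum_add_distrib]
  map_smul' c f := by
    funext p
    by_cases h : p.2 = -p.1 <;>
      simp only [h, if_true, if_false, Pi.smul_apply, smul_eq_mul, RingHom.id_apply,
        Finset.mul_sum, mul_zero]
    · exact Finset.sum_congr rfl fun l _ => by ring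

/-- The operator `T^{(a,b)}` on `V^{⊗k} = (Fin k → SIdx r) → K` (for `a ≠ b`): it acts as
`T` on the `a`-th and `b`-th tensor factors and as the identity on all other factors. -/
def liftAB {k : ℕ} (T : Module.End K (SIdx r × SIdx r → K)) (a b : Fin k) :
    Module.End K ((Fin k → SIdx r) → K) where
  toFun f := fun v => ∑ l : SIdx r, ∑ m : SIdx r,
    T (Pi.single (l, m) 1) (v a, v b) * f (Function.update (Function.update v a l) b m)
  map_add' f g := by
    funext v
    simp [mul_add, Finset.sum_add_distrib]
  map_smul' c f := by
    funext v
    simp only [Pi.smul_apply, smul_eq_mul, RingHom.id_apply, Finset.mul_sum]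
    congr 1; funext l; congr 1; funext m; ring

/-- The idempotent `C_q = (1 − P_q)/2 − Q_q/(2r)` on `V ⊗ V`. -/
def Cq (q : SympParam K r) : Module.End K (SIdx r × SIdx r → K) :=
  (2 : K)⁻¹ • (1 - Pq q) - (2 * (r : K))⁻¹ • Qq q

set_option linter.unusedSectionVars false

theorem SIdx.neg_val (i : SIdx r) : (-i).1 = -i.1 := rfl

theorem SIdx.neg_neg (i : SIdx r) : - -i = i := Subtype.ext (_root_.neg_neg i.1)

theorem SIdx.val_ne_zero (i : SIdx r) : i.1 ≠ 0 := (Finset.mem_erase.mp i.2).1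

theorem SIdx.neg_ne_self (i : SIdx r) : -i ≠ i := fun h => by
  have h1 := congrArg Subtype.val h
  have h2 := i.val_ne_zero
  rw [SIdx.neg_val] at h1
  omega

theorem SIdx.neg_eq_iff (i j : SIdx r) : -i = j ↔ i = -j :=
  ⟨fun h => h ▸ (SIdx.neg_neg i).symm, fun h => h ▸ SIdx.neg_neg j⟩

theorem SIdx.card : Fintype.card (SIdx r) = 2 * r := by
  rw [Fintype.card_coe, Finset.card_erase_of_mem (by simp), Int.card_Icc]
  omega

theorem sgn_neg (i : SIdx r) : sgn K (-i) = -sgn K i := by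
  have h := i.val_ne_zero
  unfold sgn
  rw [SIdx.neg_val]
  by_cases h0 : 0 < i.1
  · simp [h0, not_lt.mpr h0.le]
  · simp [h0, show i.1 < 0 by omega]

theorem sgn_mul_self (i : SIdx r) : sgn K i * sgn K i = 1 := by
  unfold sgn
  split_ifs <;> simp

theorem sgn_ne_zero (i : SIdx r) : sgn K i ≠ 0 := left_ne_zero_of_mul_eq_one (sgn_mul_self i)

namespace SympParam

theorem qm_mul_qm (q : SympParam K r) (i j : SIdx r) : q.qm i j * q.qm j i = 1 := by
  rw [q.qm_symm i j, inv_mul_cancel₀ (q.qm_ne j i)]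

theorem qm_self_neg (q : SympParam K r) (i : SIdx r) : q.qm i (-i) = (q.qv i ^ 2)⁻¹ := by
  rw [q.qm_symm, q.qm_neg, q.qm_diag, inv_one, one_mul]

theorem qm_mul_qm_neg_left (q : SympParam K r) (i j : SIdx r) :
    q.qm i j * q.qm (-i) j = q.qv j ^ 2 := by
  rw [q.qm_neg, mul_inv_cancel_left₀ (q.qm_ne i j)]

theorem qm_mul_qm_neg_right (q : SympParam K r) (i j : SIdx r) :
    q.qm i j * q.qm i (-j) = (q.qv i ^ 2)⁻¹ := by
  rw [q.qm_symm i j, q.qm_symm i (-j), ← mul_inv, qm_mul_qm_neg_left]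

/-- A twisted antisymmetric function of two indices, `τ_{ij} = -q_{ij} τ_{ji}`, normalized so
that `τ_{ij} τ_{-i,j} = 1` for `i ≠ ±j` and `τ_{i,-i} = ε_i q_i⁻¹`. -/
def tau (q : SympParam K r) (i j : SIdx r) : K :=
  if i = j then 0
  else if j = -i then sgn K i * (q.qv i)⁻¹
  else if |i.1| < |j.1| then (if 0 < j.1 then 1 else (q.qv i ^ 2)⁻¹)
  else -q.qm i j * (if 0 < i.1 then 1 else (q.qv j ^ 2)⁻¹)

theorem tau_self (q : SympParam K r) (i : SIdx r) : q.tau i i = 0 := if_pos rfl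

theorem tau_self_neg (q : SympParam K r) (i : SIdx r) :
    q.tau i (-i) = sgn K i * (q.qv i)⁻¹ := by
  rw [tau, if_neg (SIdx.neg_ne_self i).symm, if_pos rfl]

theorem tau_ne_zero (q : SympParam K r) {i j : SIdx r} (h : i ≠ j) : q.tau i j ≠ 0 := by
  have h1 := q.qv_ne i
  have h2 := q.qv_ne j
  have h3 := q.qm_ne i j
  have h4 := sgn_ne_zero (K := K) i
  unfold tau
  rw [if_neg h]
  split_ifs <;> simp [*]

theorem abs_val_ne {i j : SIdx r} (h : i ≠ j) (h' : j ≠ -i) : |i.1| ≠ |j.1| := fun h0 => by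
  rcases abs_eq_abs.mp h0 with h1 | h1
  · exact h (Subtype.ext h1)
  · exact h' (Subtype.ext (by rw [SIdx.neg_val]; omega))

theorem tau_swap (q : SympParam K r) (i j : SIdx r) : q.tau i j = -q.qm i j * q.tau j i := by
  by_cases h : i = j
  · subst h; simp [tau_self]
  by_cases h' : j = -i
  · subst h'
    have h2 := q.tau_self_neg (-i)
    rw [SIdx.neg_neg] at h2
    rw [tau_self_neg, h2, qm_self_neg, sgn_neg, q.qv_neg]
    have := q.qv_ne i
    field_simp
  have h'' : i ≠ -j := fun h0 => h' (by rw [h0, SIdx.neg_neg])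
  have hab := abs_val_ne h h'
  unfold tau
  rw [if_neg h, if_neg h', if_neg (Ne.symm h), if_neg h'']
  by_cases hlt : |i.1| < |j.1|
  · rw [if_pos hlt, if_neg hlt.le.not_gt, ← mul_assoc, neg_mul_neg, qm_mul_qm, one_mul]
  · rw [if_neg hlt, if_pos (lt_of_le_of_ne (not_lt.mp hlt) hab.symm)]

theorem tau_mul_tau_neg (q : SympParam K r) {i j : SIdx r} (h : i ≠ j) (h' : -i ≠ j) :
    q.tau i j * q.tau (-i) j = 1 := by
  have hab := abs_val_ne h h'.symm
  have h0 := i.val_ne_zero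
  have h1 := q.qv_ne i
  have h2 := q.qv_ne j
  have h3 := q.qm_mul_qm_neg_left i j
  unfold tau
  rw [if_neg h, if_neg h'.symm, if_neg h', SIdx.neg_neg, if_neg (Ne.symm h), SIdx.neg_val, abs_neg,
    q.qv_neg]
  by_cases hlt : |i.1| < |j.1|
  · rw [if_pos hlt, if_pos hlt]
    split_ifs
    · simp
    · field_simp
  · rw [if_neg hlt, if_neg hlt, mul_mul_mul_comm, neg_mul_neg, h3]
    rcases lt_or_gt_of_ne h0 with h4 | h4
    · rw [if_neg h4.le.not_gt, if_pos (by omega), mul_one, mul_inv_cancel₀ (pow_ne_zero 2 h2)]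
    · rw [if_pos h4, if_neg (by omega), one_mul, mul_inv_cancel₀ (pow_ne_zero 2 h2)]

/-- The product of `τ_{ij}` over all pairs of entries of a list, taken in order. -/
def chi (q : SympParam K r) : List (SIdx r) → K
  | [] => 1
  | x :: l => (l.map (q.tau x)).prod * chi q l

/-- A function on words that picks up the factor `-q_{xy}` when adjacent letters `x`, `y` are
exchanged. -/
def IsTwistedAlternating (q : SympParam K r) (F : List (SIdx r) → K) : Prop :=
  ∀ l₁ x y l₂, F (l₁ ++ x :: y :: l₂) = -q.qm x y * F (l₁ ++ y :: x :: l₂)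

theorem isTwistedAlternating_chi (q : SympParam K r) : q.IsTwistedAlternating q.chi := by
  intro l₁ x y l₂
  induction l₁ with
  | nil =>
    simp only [List.nil_append, chi, List.map_cons, List.prod_cons]
    rw [q.tau_swap x y]
    ring
  | cons z l₁ ih =>
    simp only [List.cons_append, chi]
    rw [ih, ((List.Perm.swap y x l₂).append_left l₁ |>.map (q.tau z)).prod_eq]
    ring

theorem chi_ne_zero (q : SympParam K r) {l : List (SIdx r)} (h : l.Nodup) : q.chi l ≠ 0 := by
  induction l with
  | nil => simp [chi]
  | cons x l ih =>
    rw [List.nodup_cons] at h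
    refine mul_ne_zero (List.prod_ne_zero fun h0 => ?_) (ih h.2)
    obtain ⟨y, hy, hxy⟩ := List.mem_map.mp h0
    exact q.tau_ne_zero (fun e : x = y => h.1 (e ▸ hy)) hxy

theorem chi_pair_cons (q : SympParam K r) (i : SIdx r) (l : List (SIdx r)) :
    sgn K i * q.qv i * q.chi (i :: -i :: l) = if i ∉ l ∧ -i ∉ l then q.chi l else 0 := by
  have h1 : (l.map (q.tau i)).prod * (l.map (q.tau (-i))).prod =
      if i ∉ l ∧ -i ∉ l then 1 else 0 := by
    induction l with
    | nil => simp
    | cons y l ih =>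
      simp only [List.map_cons, List.prod_cons, List.mem_cons, not_or]
      rw [mul_mul_mul_comm, ih]
      by_cases h : i = y
      · simp [h, tau_self]
      by_cases h' : -i = y
      · simp [h', tau_self]
      simp [h, h', q.tau_mul_tau_neg h h']
  have h2 : sgn K i * q.qv i * q.chi (i :: -i :: l) = (sgn K i * sgn K i) *
      (q.qv i * (q.qv i)⁻¹) *
      ((l.map (q.tau i)).prod * (l.map (q.tau (-i))).prod) * q.chi l := by
    simp only [chi, List.map_cons, List.prod_cons, tau_self_neg]
    ring
  rw [h2, sgn_mul_self, mul_inv_cancel₀ (q.qv_ne i), h1]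
  split_ifs <;> simp

namespace IsTwistedAlternating

variable {q : SympParam K r} {F : List (SIdx r) → K}

theorem div_chi_eq_of_perm (hF : q.IsTwistedAlternating F) {l l' : List (SIdx r)} (h : l.Perm l') :
    F l / q.chi l = F l' / q.chi l' := by
  suffices ∀ p, F (p ++ l) / q.chi (p ++ l) = F (p ++ l') / q.chi (p ++ l') from this []
  induction h with
  | nil => intro p; rfl
  | cons x _ ih => intro p; simpa using ih (p ++ [x])
  | swap x y l =>
    intro p
    rw [hF, q.isTwistedAlternating_chi p y x l,
      mul_div_mul_left _ _ (neg_ne_zero.mpr (q.qm_ne y x))]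
  | trans _ _ ih₁ ih₂ => intro p; rw [ih₁, ih₂]

theorem eq_zero_of_perm (hF : q.IsTwistedAlternating F) {l l' : List (SIdx r)} (h : l.Perm l')
    (h0 : F l = 0) : F l' = 0 := by
  suffices ∀ p, F (p ++ l) = 0 → F (p ++ l') = 0 from this [] h0
  clear h0
  induction h with
  | nil => intro p h; exact h
  | cons x _ ih => intro p h; simpa using ih (p ++ [x]) (by simpa using h)
  | swap x y l => intro p h; rw [hF, h, mul_zero]
  | trans _ _ ih₁ ih₂ => intro p h; exact ih₂ p (ih₁ p h)

theorem eq_zero_of_not_nodup (hF : q.IsTwistedAlternating F) {l : List (SIdx r)}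
    (h : ¬ l.Nodup) : F l = 0 := by
  obtain ⟨x, hx⟩ := List.exists_duplicate_iff_not_nodup.mpr h
  obtain ⟨l', hl'⟩ := (List.duplicate_iff_sublist.mp hx).exists_perm_append
  refine hF.eq_zero_of_perm hl'.symm (self_eq_neg.mp ?_)
  simpa [q.qm_diag] using hF [] x x l'

theorem eq_chi_mul (hF : q.IsTwistedAlternating F) (l : List (SIdx r)) :
    F l = q.chi l * (F l.toFinset.toList / q.chi l.toFinset.toList) := by
  by_cases h : l.Nodup
  · rw [hF.div_chi_eq_of_perm (List.toFinset_toList h), mul_div_cancel₀ _ (q.chi_ne_zero h)]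
  · rw [hF.eq_zero_of_not_nodup h, q.isTwistedAlternating_chi.eq_zero_of_not_nodup h, zero_mul]

theorem append_pair (hF : q.IsTwistedAlternating F) (l₁ l₂ : List (SIdx r)) (i : SIdx r) :
    F (l₁ ++ i :: -i :: l₂) =
      (l₁.map fun x => (q.qv x ^ 2)⁻¹).prod * F (i :: -i :: (l₁ ++ l₂)) := by
  induction l₁ using List.reverseRecOn generalizing l₂ with
  | nil => simp
  | append_singleton l x ih =>
    have h1 := hF l x i (-i :: l₂)
    have h2 := hF (l ++ [i]) x (-i) l₂
    simp only [List.append_assoc, List.cons_append, List.nil_append] at h1 h2 ⊢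
    rw [h1, h2, ih, ← mul_assoc, neg_mul_neg, qm_mul_qm_neg_right]
    simp
    ring

end IsTwistedAlternating

end SympParam
section PairOperators

variable {R : Type*}

/-- The sum of the values of `f` at all sets obtained by adjoining a pair `{i, -i}` disjoint from
`S`; each pair is counted twice, as `i` and as `-i`. -/
def addPairSum [AddCommMonoid R] (f : Finset (SIdx r) → R) (S : Finset (SIdx r)) : R :=
  ∑ i, if i ∉ S ∧ -i ∉ S then f (insert i (insert (-i) S)) else 0

/-- The sum of the values of `g` at all sets obtained by deleting a pair `{i, -i}` contained
in `S`; each pair is counted twice. -/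
def erasePairSum [AddCommMonoid R] (g : Finset (SIdx r) → R) (S : Finset (SIdx r)) : R :=
  ∑ i, if i ∈ S ∧ -i ∈ S then g ((S.erase i).erase (-i)) else 0

theorem sum_erasePairSum_mul (f g : Finset (SIdx r) → ℚ) :
    ∑ S, erasePairSum g S * f S = ∑ S, g S * addPairSum f S := by
  simp only [erasePairSum, addPairSum, Finset.sum_mul, Finset.mul_sum]
  rw [Finset.sum_comm, Finset.sum_comm (f := fun S i => g S * _)]
  refine Finset.sum_congr rfl fun i _ => ?_
  simp only [ite_mul, mul_ite, zero_mul, mul_zero, ← Finset.sum_filter]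
  have hi := SIdx.neg_ne_self i
  refine Finset.sum_nbij' (fun S => (S.erase i).erase (-i)) (fun S => insert i (insert (-i) S))
    ?_ ?_ ?_ ?_ ?_
  · simp
  · simp
  · intro S hS
    simp only [Finset.mem_filter_univ] at hS
    rw [Finset.insert_erase (Finset.mem_erase.mpr ⟨hi, hS.2⟩), Finset.insert_erase hS.1]
  · intro S hS
    simp only [Finset.mem_filter_univ] at hS
    rw [Finset.erase_insert (by simp [hS.1, hi.symm]), Finset.erase_insert hS.2]
  · intro S hS
    simp only [Finset.mem_filter_univ] at hS
    rw [Finset.insert_erase (Finset.mem_erase.mpr ⟨hi, hS.2⟩), Finset.insert_erase hS.1]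

theorem sum_indicator_mem (S : Finset (SIdx r)) :
    ∑ i : SIdx r, (if i ∈ S then (1 : ℚ) else 0) = S.card := by
  rw [Finset.sum_boole, Finset.filter_univ_mem]

theorem sum_indicator_neg_mem (S : Finset (SIdx r)) :
    ∑ i : SIdx r, (if -i ∈ S then (1 : ℚ) else 0) = S.card := by
  rw [← Equiv.sum_comp (⟨fun i => -i, fun i => -i, SIdx.neg_neg, SIdx.neg_neg⟩ : SIdx r ≃ SIdx r)]
  simp only [Equiv.coe_fn_mk, SIdx.neg_neg]
  exact sum_indicator_mem S

theorem addPairSum_erasePairSum (g : Finset (SIdx r) → ℚ) (S : Finset (SIdx r)) :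
    addPairSum (erasePairSum g) S =
      erasePairSum (addPairSum g) S + 4 * ((r : ℚ) - S.card) * g S := by
  have key : ∀ i j : SIdx r,
      (if i ∉ S ∧ -i ∉ S then
        (if j ∈ insert i (insert (-i) S) ∧ -j ∈ insert i (insert (-i) S) then
          g (((insert i (insert (-i) S)).erase j).erase (-j)) else 0) else 0) =
      (if j ∈ S ∧ -j ∈ S then
        (if i ∉ (S.erase j).erase (-j) ∧ -i ∉ (S.erase j).erase (-j) then
          g (insert i (insert (-i) ((S.erase j).erase (-j)))) else 0) else 0) +
      (if j = i ∨ j = -i then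
        (1 - (if i ∈ S then (1 : ℚ) else 0) - (if -i ∈ S then 1 else 0)) * g S else 0) := by
    intro i j
    have hi := SIdx.neg_ne_self i
    have hj := SIdx.neg_ne_self j
    by_cases h : j = i ∨ j = -i
    · rw [if_pos h]
      have e1 : i ∉ S → -i ∉ S → ((insert i (insert (-i) S)).erase j).erase (-j) = S := by
        intro h1 h2
        ext x
        rcases h with rfl | rfl <;> simp [SIdx.neg_neg] <;> grind
      have e2 : i ∈ S → -i ∈ S → insert i (insert (-i) ((S.erase j).erase (-j))) = S := by
        intro h1 h2
        ext x
        rcases h with rfl | rfl <;> simp [SIdx.neg_neg] <;> grind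
      by_cases h1 : i ∈ S <;> by_cases h2 : -i ∈ S
      · rcases h with rfl | rfl <;> simp [SIdx.neg_neg, h1, h2] <;> simp_all [SIdx.neg_neg]
      · rcases h with rfl | rfl <;> simp [SIdx.neg_neg, h1, h2]
      · rcases h with rfl | rfl <;> simp [SIdx.neg_neg, h1, h2]
      · rcases h with rfl | rfl <;> simp [SIdx.neg_neg, h1, h2] <;> simp_all [SIdx.neg_neg]
    · rw [if_neg h, add_zero]
      rw [not_or] at h
      have a1 : j ≠ i := h.1
      have a2 : j ≠ -i := h.2
      have a3 : -j ≠ i := fun e => a2 ((SIdx.neg_eq_iff j i).mp e)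
      have a4 : -j ≠ -i := fun e => a1 (by rw [SIdx.neg_eq_iff, SIdx.neg_neg] at e; exact e)
      have e : ((insert i (insert (-i) S)).erase j).erase (-j) =
          insert i (insert (-i) ((S.erase j).erase (-j))) := by
        ext x
        simp only [Finset.mem_erase, Finset.mem_insert]
        grind
      rw [e]
      simp only [Finset.mem_erase, Finset.mem_insert]
      simp only [a1, a2, a3, a4, a1.symm, a2.symm, a3.symm, a4.symm, false_or, ne_eq,
        not_false_eq_true, true_and]
      split_ifs <;> rfl
  have hsum : ∑ i : SIdx r,
      (1 - (if i ∈ S then (1 : ℚ) else 0) - (if -i ∈ S then 1 else 0)) =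
      2 * ((r : ℚ) - S.card) := by
    rw [Finset.sum_sub_distrib, Finset.sum_sub_distrib, sum_indicator_neg_mem,
      sum_indicator_mem, Finset.sum_const,
      Finset.card_univ, SIdx.card, nsmul_one]
    push_cast
    ring
  have hdouble : ∀ i : SIdx r, ∀ c : ℚ,
      ∑ j : SIdx r, (if j = i ∨ j = -i then c else 0) = 2 * c := by
    intro i c
    rw [← Finset.sum_filter, Finset.sum_const,
      show (Finset.univ.filter fun j : SIdx r => j = i ∨ j = -i) = {i, -i} by ext; simp,
      Finset.card_pair (SIdx.neg_ne_self i).symm]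
    simp
  have hl : addPairSum (erasePairSum g) S = ∑ i : SIdx r, ∑ j : SIdx r,
      (if i ∉ S ∧ -i ∉ S then
        (if j ∈ insert i (insert (-i) S) ∧ -j ∈ insert i (insert (-i) S) then
          g (((insert i (insert (-i) S)).erase j).erase (-j)) else 0) else 0) := by
    simp only [addPairSum, erasePairSum]
    refine Finset.sum_congr rfl fun i _ => ?_
    split_ifs <;> simp
  have hr : erasePairSum (addPairSum g) S = ∑ j : SIdx r, ∑ i : SIdx r,
      (if j ∈ S ∧ -j ∈ S then
        (if i ∉ (S.erase j).erase (-j) ∧ -i ∉ (S.erase j).erase (-j) then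
          g (insert i (insert (-i) ((S.erase j).erase (-j)))) else 0) else 0) := by
    simp only [addPairSum, erasePairSum]
    refine Finset.sum_congr rfl fun i _ => ?_
    split_ifs <;> simp
  rw [hl, hr, Finset.sum_comm (s := Finset.univ) (t := Finset.univ)
    (f := fun j i : SIdx r => if j ∈ S ∧ -j ∈ S then _ else _)]
  simp only [key, Finset.sum_add_distrib, hdouble]
  rw [← Finset.mul_sum, ← Finset.sum_mul, hsum]
  ring

theorem exists_addPairSum_eq_single (S₀ : Finset (SIdx r)) :
    ∃ f : Finset (SIdx r) → ℚ, ∀ S : Finset (SIdx r), S.card < r →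
      addPairSum f S = if S = S₀ then 1 else 0 := by
  let e : Finset (SIdx r) → ℚ := fun S => if S.card < r then 0 else 4 * r + 1
  let E : (Finset (SIdx r) → ℚ) →ₗ[ℚ] (Finset (SIdx r) → ℚ) :=
    { toFun := fun g S => addPairSum (erasePairSum g) S + e S * g S
      map_add' := fun g g' => by
        funext S
        simp only [addPairSum, erasePairSum, Pi.add_apply, mul_add]
        simp only [ite_add_zero, Finset.sum_add_distrib]
        ring
      map_smul' := fun c g => by
        funext S
        simp only [addPairSum, erasePairSum, Pi.smul_apply, smul_eq_mul, RingHom.id_apply, mul_add,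
          Finset.mul_sum, mul_ite, mul_zero]
        ring }
  have hE : ∀ g S, E g S = addPairSum (erasePairSum g) S + e S * g S := fun _ _ => rfl
  have hinj : Function.Injective E := by
    rw [injective_iff_map_eq_zero]
    intro g hg
    have hpos : ∀ S : Finset (SIdx r), 0 < 4 * ((r : ℚ) - S.card) + e S := by
      intro S
      by_cases h : S.card < r
      · have : (S.card : ℚ) < r := by exact_mod_cast h
        simp only [e, if_pos h]
        linarith
      · have h1 : S.card ≤ 2 * r := S.card_le_univ.trans_eq SIdx.card
        have : (S.card : ℚ) ≤ 2 * r := by exact_mod_cast h1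
        simp only [e, if_neg h]
        linarith
    have h0 : ∑ S, g S * E g S = ∑ S, addPairSum g S * addPairSum g S +
        ∑ S, (4 * ((r : ℚ) - S.card) + e S) * (g S * g S) := by
      have h1 : ∑ S, g S * erasePairSum (addPairSum g) S =
          ∑ S, addPairSum g S * addPairSum g S := by
        rw [← sum_erasePairSum_mul g]
        exact Finset.sum_congr rfl fun S _ => mul_comm _ _
      rw [← h1, ← Finset.sum_add_distrib]
      refine Finset.sum_congr rfl fun S _ => ?_
      rw [hE, addPairSum_erasePairSum]
      ring
    rw [hg] at h0
    simp only [Pi.zero_apply, mul_zero, Finset.sum_const_zero] at h0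
    have h1 : 0 ≤ ∑ S, addPairSum g S * addPairSum g S :=
      Finset.sum_nonneg fun S _ => mul_self_nonneg _
    have h2 : ∀ S ∈ Finset.univ, 0 ≤ (4 * ((r : ℚ) - S.card) + e S) * (g S * g S) :=
      fun S _ => mul_nonneg (hpos S).le (mul_self_nonneg _)
    have h3 := (Finset.sum_eq_zero_iff_of_nonneg h2).mp
      (le_antisymm (by linarith) (Finset.sum_nonneg h2))
    funext S
    exact mul_self_eq_zero.mp ((mul_eq_zero.mp (h3 S (Finset.mem_univ S))).resolve_left (hpos S).ne')
  obtain ⟨g, hg⟩ := LinearMap.injective_iff_surjective.mp hinj (Pi.single S₀ 1)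
  refine ⟨erasePairSum g, fun S hS => ?_⟩
  have := congrFun hg S
  simpa [hE, e, hS, Pi.single_apply] using this

end PairOperators
section Relations

theorem liftAB_single {k : ℕ} (T : Module.End K (SIdx r × SIdx r → K)) {a b : Fin k} (hab : a ≠ b)
    (v : Fin k → SIdx r) :
    liftAB T a b (Pi.single v 1) = ∑ x, ∑ y, T (Pi.single (v a, v b) 1) (x, y) •
      (Pi.single (Function.update (Function.update v a x) b y) 1 : (Fin k → SIdx r) → K) := by
  have key : ∀ (u w : Fin k → SIdx r) (x y : SIdx r),
      w = Function.update (Function.update u a x) b y ↔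
        (x = w a ∧ y = w b ∧ ∀ c, c ≠ a → c ≠ b → w c = u c) := by
    intro u w x y
    constructor
    · rintro rfl
      refine ⟨by simp [hab], by simp, fun c h1 h2 => by simp [h1, h2]⟩
    · rintro ⟨rfl, rfl, h⟩
      funext c
      by_cases h2 : c = b
      · subst h2; simp
      by_cases h1 : c = a
      · subst h1; simp [h2]
      simp [h1, h2, h c h1 h2]
  funext u
  simp only [liftAB, LinearMap.coe_mk, AddHom.coe_mk, Finset.sum_apply, Pi.smul_apply, smul_eq_mul,
    Pi.single_apply]
  have hcomm : (∀ c, ¬c = a → ¬c = b → v c = u c) ↔ ∀ c, ¬c = a → ¬c = b → u c = v c :=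
    forall₃_congr fun _ _ _ => eq_comm
  simp only [eq_comm (b := v), key, mul_ite, mul_one, mul_zero, ite_and]
  simp [hcomm]

theorem sum_Cq_single_mul (q : SympParam K r) (h : SIdx r → SIdx r → K) (l m : SIdx r) :
    ∑ x, ∑ y, Cq q (Pi.single (l, m) 1) (x, y) * h x y =
      2⁻¹ * (h l m - q.qm l m * h m l) - (2 * (r : K))⁻¹ *
        ((if m = -l then sgn K l * (q.qv l)⁻¹ else 0) *
          ∑ i, sgn K i * q.qv i * h i (-i)) := by
  have hQ : ∀ x y, Qq q (Pi.single (l, m) 1) (x, y) =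
      if y = -x then sgn K x * q.qv x * (if m = -l then sgn K l * (q.qv l)⁻¹ else 0) else 0 := by
    intro x y
    simp only [Qq, LinearMap.coe_mk, AddHom.coe_mk, Pi.single_apply, Prod.mk.injEq, ite_and]
    simp [eq_comm]
  have hP : ∀ x y, Pq q (Pi.single (l, m) 1) (x, y) =
      if x = m then (if y = l then q.qm l m else 0) else 0 := by
    intro x y
    simp only [Pq, LinearMap.coe_mk, AddHom.coe_mk, Pi.single_apply, Prod.mk.injEq]
    split_ifs <;> simp_all
  have h1 : ∀ x y, (Pi.single (l, m) 1 : SIdx r × SIdx r → K) (x, y) =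
      if x = l then (if y = m then 1 else 0) else 0 := by
    intro x y
    simp only [Pi.single_apply, Prod.mk.injEq, ite_and]
  simp only [Cq, LinearMap.sub_apply, LinearMap.smul_apply, Pi.sub_apply, Pi.smul_apply,
    Module.End.one_apply, smul_eq_mul, hQ, hP, h1, sub_mul, mul_sub, Finset.sum_sub_distrib]
  congr 1
  · congr 1
    · simp [ite_mul]
    · simp [ite_mul, mul_assoc]
  · simp only [mul_ite, ite_mul, mul_zero, zero_mul, Finset.sum_ite_eq', Finset.mem_univ, if_true,
      Finset.mul_sum]
    simp
    split_ifs
    · exact Finset.sum_congr rfl fun i _ => by ring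
    · rfl

theorem forall_sub_sum_Cq_eq_zero_iff (hr : 1 ≤ r) (q : SympParam K r) (h : SIdx r → SIdx r → K) :
    (∀ l m, h l m - ∑ x, ∑ y, Cq q (Pi.single (l, m) 1) (x, y) * h x y = 0) ↔
      (∀ l m, h l m = -q.qm l m * h m l) ∧ ∑ i, sgn K i * q.qv i * h i (-i) = 0 := by
  have hr0 : (r : K) ≠ 0 := by
    rw [Nat.cast_ne_zero]
    omega
  simp only [sum_Cq_single_mul]
  generalize ∑ i, sgn K i * q.qv i * h i (-i) = ω
  refine ⟨fun H => ?_, fun ⟨h1, h2⟩ l m => ?_⟩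
  · have h1 : ∀ l m, h l m = -q.qm l m * h m l := by
      intro l m
      have e1 := H l m
      have e2 := H m l
      have e3 : q.qm l m * (if l = -m then sgn K m * (q.qv m)⁻¹ else 0) =
          -(if m = -l then sgn K l * (q.qv l)⁻¹ else 0) := by
        by_cases hm : m = -l
        · subst hm
          have := q.qv_ne l
          rw [if_pos (SIdx.neg_neg l).symm, if_pos rfl, q.qm_self_neg, sgn_neg, q.qv_neg]
          field_simp
        · rw [if_neg hm, if_neg fun e => hm (by rw [e, SIdx.neg_neg])]
          simp
      have e4 := q.qm_mul_qm l m
      linear_combination e1 + q.qm l m * e2 - (2 * (r : K))⁻¹ * ω * e3 - 2⁻¹ * h l m * e4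
    refine ⟨h1, ?_⟩
    let i : SIdx r := ⟨1, by simp; omega⟩
    have e1 := H i (-i)
    have e2 := h1 i (-i)
    rw [if_pos rfl] at e1
    have e3 : (2 * (r : K))⁻¹ * (sgn K i * (q.qv i)⁻¹) * ω = 0 := by
      linear_combination e1 - 2⁻¹ * e2
    have := sgn_ne_zero (K := K) i
    have := q.qv_ne i
    simpa [*] using e3
  · rw [h2]
    linear_combination 2⁻¹ * h1 l m

end Relations

section Words

variable {k : ℕ}

/-- The values of a functional on `V^{⊗k}` at pure tensors, indexed by words; words of length
different from `k` get the value `0`. -/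
def wordFun (φ : Module.Dual K ((Fin k → SIdx r) → K)) (l : List (SIdx r)) : K :=
  if h : l.length = k then φ (Pi.single (fun i => l.get (i.cast h.symm)) 1) else 0

theorem wordFun_ofFn (φ : Module.Dual K ((Fin k → SIdx r) → K)) (v : Fin k → SIdx r) :
    wordFun φ (List.ofFn v) = φ (Pi.single v 1) := by
  rw [wordFun, dif_pos List.length_ofFn]
  congr 2
  funext i
  simp

theorem wordFun_of_length_ne (φ : Module.Dual K ((Fin k → SIdx r) → K)) {l : List (SIdx r)}
    (h : l.length ≠ k) : wordFun φ l = 0 := dif_neg h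

theorem ofFn_update_update {α : Type*} (v : Fin k → α) (a : ℕ) (ha : a + 1 < k) (x y : α) :
    List.ofFn (Function.update (Function.update v ⟨a, by omega⟩ x) ⟨a + 1, ha⟩ y) =
      (List.ofFn v).take a ++ x :: y :: (List.ofFn v).drop (a + 2) := by
  apply List.ext_getElem
  · simp
    omega
  · intro n h1 h2
    simp only [List.getElem_ofFn, List.getElem_append, List.getElem_cons, List.length_take,
      List.length_ofFn, Function.update_apply, Fin.mk.injEq, List.getElem_take, List.getElem_drop]
    rw [List.length_ofFn] at h1
    split_ifs <;> first | rfl | omega | (congr 2; omega)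

theorem apply_one_sub_liftAB_single (q : SympParam K r) (φ : Module.Dual K ((Fin k → SIdx r) → K))
    (v : Fin k → SIdx r) (a : ℕ) (ha : a + 1 < k) :
    φ ((1 - liftAB (Cq q) ⟨a, by omega⟩ ⟨a + 1, ha⟩ : Module.End K ((Fin k → SIdx r) → K))
        (Pi.single v 1)) =
      wordFun φ (List.ofFn v) - ∑ x, ∑ y,
        Cq q (Pi.single (v ⟨a, by omega⟩, v ⟨a + 1, ha⟩) 1) (x, y) *
          wordFun φ ((List.ofFn v).take a ++ x :: y :: (List.ofFn v).drop (a + 2)) := by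
  rw [LinearMap.sub_apply, map_sub, Module.End.one_apply, wordFun_ofFn,
    liftAB_single _ (by simp)]
  simp only [map_sum, map_smul, smul_eq_mul, ← ofFn_update_update _ _ ha, wordFun_ofFn]

theorem forall_apply_one_sub_liftAB_eq_zero_iff (q : SympParam K r)
    (φ : Module.Dual K ((Fin k → SIdx r) → K)) :
    (∀ (a : Fin (k - 1)) (g : (Fin k → SIdx r) → K),
      φ ((1 - liftAB (Cq q) ⟨a.1, by have := a.2; omega⟩ ⟨a.1 + 1, by have := a.2; omega⟩ :
        Module.End K ((Fin k → SIdx r) → K)) g) = 0) ↔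
    ∀ l₁ l₂ : List (SIdx r), ∀ l m, wordFun φ (l₁ ++ l :: m :: l₂) -
      ∑ x, ∑ y, Cq q (Pi.single (l, m) 1) (x, y) * wordFun φ (l₁ ++ x :: y :: l₂) = 0 := by
  constructor
  · intro H l₁ l₂ l m
    by_cases hk : l₁.length + 2 + l₂.length = k
    · have hlen : (l₁ ++ l :: m :: l₂).length = k := by simp; omega
      let v : Fin k → SIdx r := fun i => (l₁ ++ l :: m :: l₂).get (i.cast hlen.symm)
      have hv : List.ofFn v = l₁ ++ l :: m :: l₂ := by
        apply List.ext_getElem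
        · simp only [List.length_ofFn, hlen]
        · intro n h1 h2
          simp [v]
      have h1 := H ⟨l₁.length, by omega⟩ (Pi.single v 1)
      rw [apply_one_sub_liftAB_single, hv] at h1
      simpa [v] using h1
    · have h0 : ∀ x y, wordFun φ (l₁ ++ x :: y :: l₂) = 0 := fun x y =>
        wordFun_of_length_ne φ (by simp; omega)
      simp [h0]
  · intro H a g
    have ha := a.2
    rw [← LinearMap.comp_apply]
    refine LinearMap.congr_fun (f := φ ∘ₗ _) (g := 0) (LinearMap.pi_ext' fun v => ?_) g
    refine LinearMap.ext_ring ?_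
    have h1 := H ((List.ofFn v).take a) ((List.ofFn v).drop (a + 2)) (v ⟨a, by omega⟩)
      (v ⟨a + 1, by omega⟩)
    rw [← ofFn_update_update _ _ (by omega)] at h1
    simp only [Function.update_eq_self] at h1
    rw [← apply_one_sub_liftAB_single q φ v a (by omega)] at h1
    exact h1

end Words
section SubsetFunctions

variable {k : ℕ}

/-- Extension by zero of a function on `k`-element sets. -/
def extendCard (f : {S : Finset (SIdx r) // S.card = k} → K) (S : Finset (SIdx r)) : K :=
  if h : S.card = k then f ⟨S, h⟩ else 0

/-- The contraction of functions on `k`-element sets with the symplectic form. -/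
def contraction (K : Type*) [Field K] (r k : ℕ) :
    ({S : Finset (SIdx r) // S.card = k} → K) →ₗ[K]
      ({S : Finset (SIdx r) // S.card + 2 = k} → K) where
  toFun f S := addPairSum (extendCard f) S.1
  map_add' f g := by
    funext S
    simp only [addPairSum, Pi.add_apply, ← Finset.sum_add_distrib]
    refine Finset.sum_congr rfl fun i _ => ?_
    unfold extendCard
    split_ifs <;> simp
  map_smul' c f := by
    funext S
    simp only [addPairSum, Pi.smul_apply, smul_eq_mul, RingHom.id_apply, Finset.mul_sum]
    refine Finset.sum_congr rfl fun i _ => ?_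
    unfold extendCard
    split_ifs <;> simp

theorem card_insert_pair {S : Finset (SIdx r)} {i : SIdx r} (h : i ∉ S ∧ -i ∉ S) :
    (insert i (insert (-i) S)).card = S.card + 2 := by
  rw [Finset.card_insert_of_notMem (by simp [h.1, (SIdx.neg_ne_self i).symm]),
    Finset.card_insert_of_notMem h.2]

theorem contraction_surjective (hk : k ≤ r + 1) : Function.Surjective (contraction K r k) := by
  rw [← LinearMap.range_eq_top, ← top_le_iff, ← (Pi.basisFun K _).span_eq, Submodule.span_le]
  rintro _ ⟨S₀, rfl⟩
  obtain ⟨f, hf⟩ := exists_addPairSum_eq_single S₀.1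
  refine ⟨fun S => (f S.1 : K), ?_⟩
  funext S
  have hS := S.2
  have h1 := congrArg (fun x : ℚ => (x : K)) (hf S.1 (by omega))
  have h2 : contraction K r k (fun S => (f S.1 : K)) S = ((addPairSum f S.1 : ℚ) : K) := by
    simp only [contraction, LinearMap.coe_mk, AddHom.coe_mk, addPairSum, Rat.cast_sum]
    refine Finset.sum_congr rfl fun i _ => ?_
    split_ifs with hi
    · rw [extendCard, dif_pos ((card_insert_pair hi).trans hS)]
    · simp
  rw [h2, h1, Pi.basisFun_apply, Pi.single_apply]
  simp [Subtype.ext_iff, apply_ite]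

/-- The twisted alternating functional on `V^{⊗k}` attached to a function on `k`-element sets. -/
def toFunctional (q : SympParam K r) (k : ℕ) : ({S : Finset (SIdx r) // S.card = k} → K) →ₗ[K]
    Module.Dual K ((Fin k → SIdx r) → K) where
  toFun f := ∑ v, (q.chi (List.ofFn v) * extendCard f (List.ofFn v).toFinset) • LinearMap.proj v
  map_add' f g := by
    rw [← Finset.sum_add_distrib]
    refine Finset.sum_congr rfl fun v _ => ?_
    rw [← add_smul, ← mul_add]
    unfold extendCard
    split_ifs <;> simp
  map_smul' c f := by
    rw [Finset.smul_sum]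
    refine Finset.sum_congr rfl fun v _ => ?_
    rw [smul_smul]
    unfold extendCard
    split_ifs
    · simp only [Pi.smul_apply, smul_eq_mul, RingHom.id_apply, mul_left_comm]
    · simp

theorem toFunctional_single (q : SympParam K r) (f : {S : Finset (SIdx r) // S.card = k} → K)
    (v : Fin k → SIdx r) : toFunctional q k f (Pi.single v 1) =
      q.chi (List.ofFn v) * extendCard f (List.ofFn v).toFinset := by
  simp [toFunctional, Pi.single_apply]

theorem wordFun_toFunctional (q : SympParam K r) (f : {S : Finset (SIdx r) // S.card = k} → K)
    (l : List (SIdx r)) :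
    wordFun (toFunctional q k f) l = q.chi l * extendCard f l.toFinset := by
  by_cases h : l.length = k
  · obtain ⟨v, rfl⟩ : ∃ v : Fin k → SIdx r, List.ofFn v = l := by
      subst h
      exact ⟨l.get, List.ofFn_get l⟩
    rw [wordFun_ofFn, toFunctional_single]
  · rw [wordFun_of_length_ne _ h]
    by_cases hl : l.Nodup
    · rw [extendCard, dif_neg (by rwa [List.toFinset_card_of_nodup hl]), mul_zero]
    · rw [q.isTwistedAlternating_chi.eq_zero_of_not_nodup hl, zero_mul]

theorem isTwistedAlternating_toFunctional (q : SympParam K r)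
    (f : {S : Finset (SIdx r) // S.card = k} → K) :
    q.IsTwistedAlternating (wordFun (toFunctional q k f)) := by
  intro l₁ x y l₂
  simp only [wordFun_toFunctional]
  rw [q.isTwistedAlternating_chi, mul_assoc,
    List.toFinset_eq_of_perm _ _ ((List.Perm.swap y x l₂).append_left l₁)]

theorem toFunctional_injective (q : SympParam K r) : Function.Injective (toFunctional q k) := by
  rw [injective_iff_map_eq_zero]
  intro f hf
  funext S
  have h := wordFun_toFunctional q f S.1.toList
  rw [hf, Finset.toList_toFinset, extendCard, dif_pos S.2] at h
  have h0 : wordFun (0 : Module.Dual K ((Fin k → SIdx r) → K)) S.1.toList = 0 := by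
    simp [wordFun]
  rw [h0] at h
  exact (mul_eq_zero.mp h.symm).resolve_left (q.chi_ne_zero S.1.nodup_toList)

theorem exists_toFunctional_eq (q : SympParam K r) {φ : Module.Dual K ((Fin k → SIdx r) → K)}
    (h : q.IsTwistedAlternating (wordFun φ)) : ∃ f, toFunctional q k f = φ := by
  refine ⟨fun S => wordFun φ S.1.toList / q.chi S.1.toList, ?_⟩
  refine LinearMap.pi_ext' fun v => LinearMap.ext_ring ?_
  change toFunctional q k _ (Pi.single v 1) = φ (Pi.single v 1)
  rw [toFunctional_single, ← wordFun_ofFn φ, h.eq_chi_mul (List.ofFn v)]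
  by_cases hl : (List.ofFn v).Nodup
  · rw [extendCard, dif_pos (by rw [List.toFinset_card_of_nodup hl, List.length_ofFn])]
  · simp only [q.isTwistedAlternating_chi.eq_zero_of_not_nodup hl, zero_mul]

theorem sum_wordFun_toFunctional (q : SympParam K r)
    (f : {S : Finset (SIdx r) // S.card = k} → K) (l : List (SIdx r)) :
    ∑ i, sgn K i * q.qv i * wordFun (toFunctional q k f) (i :: -i :: l) =
      q.chi l * addPairSum (extendCard f) l.toFinset := by
  rw [addPairSum, Finset.mul_sum]
  refine Finset.sum_congr rfl fun i _ => ?_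
  rw [wordFun_toFunctional, ← mul_assoc, q.chi_pair_cons]
  simp only [List.mem_toFinset, List.toFinset_cons]
  split_ifs <;> simp

theorem forall_sum_wordFun_eq_zero_iff (q : SympParam K r)
    (f : {S : Finset (SIdx r) // S.card = k} → K) :
    (∀ l₁ l₂ : List (SIdx r), ∑ i, sgn K i * q.qv i *
      wordFun (toFunctional q k f) (l₁ ++ i :: -i :: l₂) = 0) ↔ contraction K r k f = 0 := by
  constructor
  · intro H
    funext S
    have h := H [] S.1.toList
    simp only [List.nil_append] at h
    rw [sum_wordFun_toFunctional, Finset.toList_toFinset] at h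
    exact (mul_eq_zero.mp h).resolve_left (q.chi_ne_zero S.1.nodup_toList)
  · intro H l₁ l₂
    simp only [(isTwistedAlternating_toFunctional q f).append_pair, mul_left_comm _ (List.prod _)]
    rw [← Finset.mul_sum, sum_wordFun_toFunctional]
    by_cases hl : (l₁ ++ l₂).Nodup
    · by_cases hk : (l₁ ++ l₂).toFinset.card + 2 = k
      · have h : addPairSum (extendCard f) (l₁ ++ l₂).toFinset = 0 := congrFun H ⟨_, hk⟩
        rw [h, mul_zero, mul_zero]
      · have h : addPairSum (extendCard f) (l₁ ++ l₂).toFinset = 0 := by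
          refine Finset.sum_eq_zero fun i _ => ?_
          split_ifs with hi
          · rw [extendCard, dif_neg (by rwa [card_insert_pair hi])]
          · rfl
        rw [h, mul_zero, mul_zero]
    · rw [q.isTwistedAlternating_chi.eq_zero_of_not_nodup hl, zero_mul, mul_zero]

theorem dualAnnihilator_relations (hr : 1 ≤ r) (q : SympParam K r) (k : ℕ) :
    (⨆ a : Fin (k - 1), LinearMap.range
      ((1 : Module.End K ((Fin k → SIdx r) → K))
        - liftAB (Cq q) ⟨a.1, by have := a.2; omega⟩
          ⟨a.1 + 1, by have := a.2; omega⟩)).dualAnnihilator =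
      (LinearMap.ker (contraction K r k)).map (toFunctional q k) := by
  ext φ
  have h1 : φ ∈ (⨆ a : Fin (k - 1), LinearMap.range
      ((1 : Module.End K ((Fin k → SIdx r) → K))
        - liftAB (Cq q) ⟨a.1, by have := a.2; omega⟩
          ⟨a.1 + 1, by have := a.2; omega⟩)).dualAnnihilator ↔
      q.IsTwistedAlternating (wordFun φ) ∧
      ∀ l₁ l₂ : List (SIdx r), ∑ i, sgn K i * q.qv i * wordFun φ (l₁ ++ i :: -i :: l₂) = 0 := by
    rw [Submodule.dualAnnihilator_iSup_eq, Submodule.mem_iInf]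
    simp only [Submodule.mem_dualAnnihilator, LinearMap.mem_range, forall_exists_index,
      forall_apply_eq_imp_iff]
    rw [forall_apply_one_sub_liftAB_eq_zero_iff]
    refine (forall₂_congr fun l₁ l₂ => forall_sub_sum_Cq_eq_zero_iff hr q
      fun x y => wordFun φ (l₁ ++ x :: y :: l₂)).trans ?_
    exact ⟨fun H => ⟨fun l₁ x y l₂ => (H l₁ l₂).1 x y, fun l₁ l₂ => (H l₁ l₂).2⟩,
      fun H l₁ l₂ => ⟨fun x y => H.1 l₁ x y l₂, H.2 l₁ l₂⟩⟩
  rw [h1, Submodule.mem_map]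
  constructor
  · rintro ⟨h2, h3⟩
    obtain ⟨f, rfl⟩ := exists_toFunctional_eq q h2
    exact ⟨f, (forall_sum_wordFun_eq_zero_iff q f).mp h3, rfl⟩
  · rintro ⟨f, hf, rfl⟩
    exact ⟨isTwistedAlternating_toFunctional q f, (forall_sum_wordFun_eq_zero_iff q f).mpr hf⟩

theorem finrank_ker_contraction (hk : k ≤ r + 1) :
    Module.finrank K (LinearMap.ker (contraction K r k)) +
      Fintype.card {S : Finset (SIdx r) // S.card + 2 = k} = (2 * r).choose k := by
  have h := LinearMap.finrank_range_add_finrank_ker (contraction K r k)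
  rw [LinearMap.range_eq_top.mpr (contraction_surjective hk), finrank_top, Module.finrank_pi,
    Module.finrank_pi, Fintype.card_finset_len, SIdx.card] at h
  rw [← h, add_comm]

end SubsetFunctions

theorem succ_succ_mul_choose_sub (n k : ℕ) (h : 2 * (k + 2) ≤ n + 2) :
    (k + 2) * (n.choose (k + 2)) =
      (n + 2 - 2 * (k + 2)) * (n + 1).choose (k + 1) + (k + 2) * n.choose k := by
  obtain ⟨m, rfl⟩ : ∃ m, n = 2 * k + 2 + m := ⟨n - (2 * k + 2), by omega⟩
  have h1 := Nat.choose_succ_right_eq (2 * k + 2 + m) k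
  have h2 := Nat.choose_succ_right_eq (2 * k + 2 + m) (k + 1)
  rw [show 2 * k + 2 + m - k = k + 2 + m by omega] at h1
  rw [show 2 * k + 2 + m - (k + 1) = k + 1 + m by omega] at h2
  rw [show 2 * k + 2 + m + 2 - 2 * (k + 2) = m by omega, Nat.choose_succ_succ]
  simp only [Nat.succ_eq_add_one]
  nlinarith

theorem finrank_quotient_eq_finrank_dualAnnihilator {V : Type*} [AddCommGroup V] [Module K V]
    [FiniteDimensional K V] (W : Submodule K V) :
    Module.finrank K (V ⧸ W) = Module.finrank K W.dualAnnihilator := by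
  have h := Subspace.finrank_add_finrank_dualAnnihilator_eq W
  rw [← Submodule.finrank_quotient_add_finrank W, add_comm] at h
  exact (Nat.add_right_cancel h).symm

/-- for `1 ≤ k ≤ r + 1`, the `k`-th graded component of the quadratic algebra
`Ξ_{C_q}(K)`, realized as the quotient of `V^{⊗k}` by the span of the images of the
operators `(1 − C_q)^{(a,a+1)}`, has dimension `((2r − 2k + 2)/k) · binom(2r+1, k−1)`
(stated multiplied by `k` to stay in `ℕ`). -/
theorem dim_component (hr : 1 ≤ r) (q : SympParam K r) (k : ℕ) (hk1 : 1 ≤ k)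
    (hk2 : k ≤ r + 1) :
    k * Module.finrank K (((Fin k → SIdx r) → K) ⧸
        (⨆ a : Fin (k - 1), LinearMap.range
          ((1 : Module.End K ((Fin k → SIdx r) → K))
            - liftAB (Cq q) ⟨a.1, by have := a.2; omega⟩ ⟨a.1 + 1, by have := a.2; omega⟩)))
      = (2 * r + 2 - 2 * k) * Nat.choose (2 * r + 1) (k - 1) := by
  have hfin := finrank_ker_contraction (K := K) hk2
  rw [finrank_quotient_eq_finrank_dualAnnihilator, dualAnnihilator_relations hr,
    ← (Submodule.equivMapOfInjective _ (toFunctional_injective q) _).finrank_eq]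
  obtain rfl | ⟨n, rfl⟩ : k = 1 ∨ ∃ n, k = n + 2 := by
    rcases k with _ | _ | n
    · omega
    · exact Or.inl rfl
    · exact Or.inr ⟨n, rfl⟩
  · have : IsEmpty {S : Finset (SIdx r) // S.card + 2 = 1} := ⟨fun S => by have := S.2; omega⟩
    rw [Fintype.card_eq_zero, Nat.choose_one_right] at hfin
    simp [← hfin]
  · simp only [Nat.add_right_cancel_iff, Fintype.card_finset_len, SIdx.card] at hfin
    have h := succ_succ_mul_choose_sub (2 * r) n (by omega)
    rw [← hfin, mul_add] at h
    exact Nat.add_right_cancel h
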